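/- Let n > 2 and let F be a generalized isotropic Berwald metric with data (μ, λ) on U ⊆ ℝ^n. Then F is R-quadratic if and only if F is a stretch metric (Σ_{ijkl} = 0) with vanishing Ē-curvature (E_{jk|l} = 0 for all j, k, l). -/

import Mathlib

/-!  Common setup: Finsler metrics on an open set `U ⊆ ℝⁿ`, in coordinates. -/

noncomputable section

open scoped BigOperators

/-- Points/vectors of `ℝⁿ`, as functions `Fin n → ℝ`. -/
abbrev Pt (n : ℕ) := Fin n → ℝ

variable {n : ℕ}

/-- Partial derivative in the fiber variable `y`, direction `yⁱ`. -/
def pdy (f : Pt n → Pt n → ℝ) (i : Fin n) : Pt n → Pt n → ℝ :=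
  fun x y => fderiv ℝ (fun y' => f x y') y (Pi.single i 1)

/-- Partial derivative in the base variable `x`, direction `xⁱ`. -/
def pdx (f : Pt n → Pt n → ℝ) (i : Fin n) : Pt n → Pt n → ℝ :=
  fun x y => fderiv ℝ (fun x' => f x' y) x (Pi.single i 1)

/-- `F²`. -/
def F2 (F : Pt n → Pt n → ℝ) : Pt n → Pt n → ℝ := fun x y => (F x y) ^ 2

/-- Fundamental tensor `g_{ij} = (1/2) ∂²(F²)/∂yⁱ∂yʲ`. -/
def gLow (F : Pt n → Pt n → ℝ) (i j : Fin n) : Pt n → Pt n → ℝ :=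
  fun x y => (1 / 2 : ℝ) * pdy (pdy (F2 F) j) i x y

/-- The fundamental tensor as a matrix. -/
def gMat (F : Pt n → Pt n → ℝ) (x y : Pt n) : Matrix (Fin n) (Fin n) ℝ :=
  Matrix.of fun i j => gLow F i j x y

/-- Inverse fundamental tensor `g^{ij}`. -/
def gInv (F : Pt n → Pt n → ℝ) (i j : Fin n) : Pt n → Pt n → ℝ :=
  fun x y => (gMat F x y)⁻¹ i j

/-- Lowered fiber variable `y_i := g_{ij} yʲ`. -/
def yLow (F : Pt n → Pt n → ℝ) (i : Fin n) : Pt n → Pt n → ℝ :=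
  fun x y => ∑ j, gLow F i j x y * y j

/-- `ℓⁱ := yⁱ / F`. -/
def ell (F : Pt n → Pt n → ℝ) (i : Fin n) : Pt n → Pt n → ℝ :=
  fun x y => y i / F x y

/-- Angular metric `h_{ij} := g_{ij} - F⁻² y_i y_j`. -/
def hLow (F : Pt n → Pt n → ℝ) (i j : Fin n) : Pt n → Pt n → ℝ :=
  fun x y => gLow F i j x y - yLow F i x y * yLow F j x y / (F x y) ^ 2

/-- `hⁱ_j := δⁱ_j - F⁻² yⁱ y_j`. -/
def hUp (F : Pt n → Pt n → ℝ) (i j : Fin n) : Pt n → Pt n → ℝ :=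
  fun x y => (if i = j then (1 : ℝ) else 0) - y i * yLow F j x y / (F x y) ^ 2

/-- Cartan torsion `C_{ijk} := (1/4) ∂³(F²)/∂yⁱ∂yʲ∂yᵏ`. -/
def Cartan (F : Pt n → Pt n → ℝ) (i j k : Fin n) : Pt n → Pt n → ℝ :=
  fun x y => (1 / 4 : ℝ) * pdy (pdy (pdy (F2 F) k) j) i x y

/-- Mean Cartan torsion `I_k := g^{ij} C_{ijk}`. -/
def mCartan (F : Pt n → Pt n → ℝ) (k : Fin n) : Pt n → Pt n → ℝ :=
  fun x y => ∑ i, ∑ j, gInv F i j x y * Cartan F i j k x y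

/-- Spray coefficients `Gⁱ`. -/
def Gspray (F : Pt n → Pt n → ℝ) (i : Fin n) : Pt n → Pt n → ℝ :=
  fun x y => (1 / 4 : ℝ) * ∑ l, gInv F i l x y *
    ((∑ k, y k * pdx (pdy (F2 F) l) k x y) - pdx (F2 F) l x y)

/-- Berwald curvature `Bⁱ_{jkl} := ∂³Gⁱ/∂yʲ∂yᵏ∂yˡ`. -/
def Bcurv (F : Pt n → Pt n → ℝ) (i j k l : Fin n) : Pt n → Pt n → ℝ :=
  pdy (pdy (pdy (Gspray F i) l) k) j

/-- Mean Berwald curvature `E_{jk} := (1/2) Bᵐ_{jkm}`. -/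
def Ecurv (F : Pt n → Pt n → ℝ) (j k : Fin n) : Pt n → Pt n → ℝ :=
  fun x y => (1 / 2 : ℝ) * ∑ m, Bcurv F m j k m x y

/-- Nonlinear connection `Nⁱ_j := ∂Gⁱ/∂yʲ`. -/
def Ncon (F : Pt n → Pt n → ℝ) (i j : Fin n) : Pt n → Pt n → ℝ :=
  pdy (Gspray F i) j

/-- Berwald connection coefficients `Γⁱ_{jk} := ∂²Gⁱ/∂yʲ∂yᵏ`. -/
def Γcon (F : Pt n → Pt n → ℝ) (i j k : Fin n) : Pt n → Pt n → ℝ :=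
  pdy (pdy (Gspray F i) k) j

/-- Horizontal (Berwald) covariant derivative of a scalar. -/
def hD0 (F : Pt n → Pt n → ℝ) (f : Pt n → Pt n → ℝ) (m : Fin n) : Pt n → Pt n → ℝ :=
  fun x y => pdx f m x y - ∑ r, Ncon F r m x y * pdy f r x y

/-- Horizontal covariant derivative of a covariant 2-tensor. -/
def hD2 (F : Pt n → Pt n → ℝ) (T : Fin n → Fin n → Pt n → Pt n → ℝ) (j k m : Fin n) :
    Pt n → Pt n → ℝ :=
  fun x y => hD0 F (T j k) m x y - (∑ r, T r k x y * Γcon F r j m x y)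
    - ∑ r, T j r x y * Γcon F r k m x y

/-- Horizontal covariant derivative of a covariant 3-tensor. -/
def hD3 (F : Pt n → Pt n → ℝ) (T : Fin n → Fin n → Fin n → Pt n → Pt n → ℝ) (i j k m : Fin n) :
    Pt n → Pt n → ℝ :=
  fun x y => hD0 F (T i j k) m x y - (∑ r, T r j k x y * Γcon F r i m x y)
    - (∑ r, T i r k x y * Γcon F r j m x y) - ∑ r, T i j r x y * Γcon F r k m x y

/-- Horizontal covariant derivative of a (1,3)-tensor `Tⁱ_{jkl}`. -/
def hD13 (F : Pt n → Pt n → ℝ) (T : Fin n → Fin n → Fin n → Fin n → Pt n → Pt n → ℝ)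
    (i j k l m : Fin n) : Pt n → Pt n → ℝ :=
  fun x y => hD0 F (T i j k l) m x y + (∑ r, T r j k l x y * Γcon F i r m x y)
    - (∑ r, T i r k l x y * Γcon F r j m x y) - (∑ r, T i j r l x y * Γcon F r k m x y)
    - ∑ r, T i j k r x y * Γcon F r l m x y

/-- Landsberg curvature `L_{ijk} := C_{ijk|m} yᵐ`. -/
def Land (F : Pt n → Pt n → ℝ) (i j k : Fin n) : Pt n → Pt n → ℝ :=
  fun x y => ∑ m, hD3 F (Cartan F) i j k m x y * y m

/-- Stretch curvature `Σ_{ijkl} := 2(L_{ijk|l} - L_{ijl|k})`. -/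
def Stretch (F : Pt n → Pt n → ℝ) (i j k l : Fin n) : Pt n → Pt n → ℝ :=
  fun x y => 2 * (hD3 F (Land F) i j k l x y - hD3 F (Land F) i j l k x y)

/-- Douglas tensor `Dⁱ_{jkl}`. -/
def Douglas (F : Pt n → Pt n → ℝ) (i j k l : Fin n) : Pt n → Pt n → ℝ :=
  fun x y => Bcurv F i j k l x y - (2 / ((n : ℝ) + 1)) *
    (Ecurv F j k x y * (if i = l then (1 : ℝ) else 0)
      + Ecurv F j l x y * (if i = k then (1 : ℝ) else 0)
      + Ecurv F k l x y * (if i = j then (1 : ℝ) else 0)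
      + pdy (Ecurv F j k) l x y * y i)

/-- Riemann curvature `Rⁱ_k`. -/
def RiemK (F : Pt n → Pt n → ℝ) (i k : Fin n) : Pt n → Pt n → ℝ :=
  fun x y => 2 * pdx (Gspray F i) k x y - (∑ j, y j * pdx (pdy (Gspray F i) k) j x y)
    + 2 * (∑ j, Gspray F j x y * Γcon F i j k x y) - ∑ j, Ncon F i j x y * Ncon F j k x y

/-- `Rⁱ_{jkl} := (1/3) ∂/∂yʲ (∂Rⁱ_k/∂yˡ - ∂Rⁱ_l/∂yᵏ)`. -/
def Riem4 (F : Pt n → Pt n → ℝ) (i j k l : Fin n) : Pt n → Pt n → ℝ :=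
  fun x y => (1 / 3 : ℝ) *
    pdy (fun x' y' => pdy (RiemK F i k) l x' y' - pdy (RiemK F i l) k x' y') j x y

/-- `F` is R-quadratic on `U`: `Rⁱ_{jkl}(x,y)` is independent of `y`. -/
def RQuadratic (U : Set (Pt n)) (F : Pt n → Pt n → ℝ) : Prop :=
  ∀ x ∈ U, ∀ y y' : Pt n, y ≠ 0 → y' ≠ 0 →
    ∀ i j k l, Riem4 F i j k l x y = Riem4 F i j k l x y'

/-- A Finsler metric on a connected open set `U ⊆ ℝⁿ` (`n ≥ 2`). -/
structure IsFinslerMetric (U : Set (Pt n)) (F : Pt n → Pt n → ℝ) : Prop where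
  dim : 2 ≤ n
  isOpen : IsOpen U
  connected : IsConnected U
  smooth : ContDiffOn ℝ (⊤ : ℕ∞) (Function.uncurry F) (U ×ˢ {y : Pt n | y ≠ 0})
  pos : ∀ x ∈ U, ∀ y : Pt n, y ≠ 0 → 0 < F x y
  homog : ∀ x ∈ U, ∀ y : Pt n, y ≠ 0 → ∀ t : ℝ, 0 < t → F x (t • y) = t * F x y
  posdef : ∀ x ∈ U, ∀ y : Pt n, y ≠ 0 → (gMat F x y).PosDef

/-- `F` is a generalized isotropic Berwald metric on `U` with data `(μ, λ)`. -/
structure IsGIB (U : Set (Pt n)) (F μ lam : Pt n → Pt n → ℝ) : Prop where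
  finsler : IsFinslerMetric U F
  smooth_mu : ContDiffOn ℝ (⊤ : ℕ∞) (Function.uncurry μ) (U ×ˢ {y : Pt n | y ≠ 0})
  smooth_lam : ContDiffOn ℝ (⊤ : ℕ∞) (Function.uncurry lam) (U ×ˢ {y : Pt n | y ≠ 0})
  homog_mu : ∀ x ∈ U, ∀ y : Pt n, y ≠ 0 → ∀ t : ℝ, 0 < t → μ x (t • y) = μ x y
  homog_lam : ∀ x ∈ U, ∀ y : Pt n, y ≠ 0 → ∀ t : ℝ, 0 < t → lam x (t • y) = t⁻¹ * lam x y
  berwald : ∀ x ∈ U, ∀ y : Pt n, y ≠ 0 → ∀ i j k l,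
    Bcurv F i j k l x y = μ x y * Cartan F j k l x y * ell F i x y
      + lam x y * (hUp F i j x y * hLow F k l x y + hUp F i k x y * hLow F j l x y
        + hUp F i l x y * hLow F j k x y)

end

noncomputable section
open scoped BigOperators

lemma isUnit_natCast {A : Type*} [CommRing A] [Algebra ℝ A] {k : ℕ} (hk : k ≠ 0) :
    IsUnit (k : A) := by
  have := (IsUnit.mk0 (k : ℝ) (Nat.cast_ne_zero.2 hk)).map (algebraMap ℝ A)
  rwa [map_natCast] at this

/-- A commutative algebra modelled on the smooth functions of `(x, y)`, together with the partial
derivatives in the base and fibre directions and the fibre coordinates. -/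
structure FiberCalculus (n : ℕ) (A : Type*) [CommRing A] [Algebra ℝ A] where
  dx : Fin n → Derivation ℝ A A
  dy : Fin n → Derivation ℝ A A
  v : Fin n → A
  dy_comm : ∀ i j a, dy i (dy j a) = dy j (dy i a)
  dx_dy : ∀ i j a, dx i (dy j a) = dy j (dx i a)
  dy_v : ∀ i j, dy i (v j) = if i = j then 1 else 0
  dx_v : ∀ i j, dx i (v j) = 0

namespace FiberCalculus

variable {n : ℕ} {A : Type*} [CommRing A] [Algebra ℝ A] (J : FiberCalculus n A) (G : Fin n → A)

/-- Berwald curvature of the spray `G`. -/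
def berwald (i j k l : Fin n) : A := J.dy j (J.dy k (J.dy l (G i)))

/-- Horizontal derivative of a scalar. -/
def hor (m : Fin n) : Derivation ℝ A A := J.dx m - ∑ r, J.dy m (G r) • J.dy r

/-- Horizontal derivative of a covector. -/
def hor1 (T : Fin n → A) (j m : Fin n) : A :=
  J.hor G m (T j) - ∑ r, T r * J.dy j (J.dy m (G r))

/-- Horizontal derivative of a covariant 2-tensor. -/
def hor2 (T : Fin n → Fin n → A) (j k m : Fin n) : A :=
  J.hor G m (T j k) - (∑ r, T r k * J.dy j (J.dy m (G r))) - ∑ r, T j r * J.dy k (J.dy m (G r))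

/-- Horizontal derivative of a covariant 3-tensor. -/
def hor3 (T : Fin n → Fin n → Fin n → A) (i j k m : Fin n) : A :=
  J.hor G m (T i j k) - (∑ r, T r j k * J.dy i (J.dy m (G r)))
    - (∑ r, T i r k * J.dy j (J.dy m (G r))) - ∑ r, T i j r * J.dy k (J.dy m (G r))

/-- Horizontal derivative of a tensor of type `(1, 3)`. -/
def hor13 (T : Fin n → Fin n → Fin n → Fin n → A) (i j k l m : Fin n) : A :=
  J.hor G m (T i j k l) + (∑ r, T r j k l * J.dy r (J.dy m (G i)))
    - (∑ r, T i r k l * J.dy j (J.dy m (G r))) - (∑ r, T i j r l * J.dy k (J.dy m (G r)))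
    - ∑ r, T i j k r * J.dy l (J.dy m (G r))

/-- Riemann curvature `Rⁱ_k` of the spray `G`. -/
def riem (i k : Fin n) : A :=
  2 * J.dx k (G i) - (∑ j, J.v j * J.dx j (J.dy k (G i)))
    + 2 * (∑ j, G j * J.dy j (J.dy k (G i))) - ∑ j, J.dy j (G i) * J.dy k (G j)

lemma hor_apply (m : Fin n) (a : A) :
    J.hor G m a = J.dx m a - ∑ r, J.dy m (G r) * J.dy r a := by
  simp only [hor, Derivation.sub_apply, ← Derivation.coeFnAddMonoidHom_apply, map_sum,
    Finset.sum_apply]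
  rfl

lemma map_two (D : Derivation ℝ A A) : D (2 : A) = 0 := by
  simpa using D.map_natCast 2

/-- The curvature of the nonlinear connection. -/
lemma dy_riem_sub (i k l : Fin n) :
    J.dy l (J.riem G i k) - J.dy k (J.riem G i l) =
      3 * (J.hor G k (J.dy l (G i)) - J.hor G l (J.dy k (G i))) := by
  simp only [riem, hor_apply, map_sub, map_add, map_sum, Derivation.leibniz, smul_eq_mul, map_two,
    J.dy_v, J.dx_dy, Finset.sum_add_distrib, ite_mul, one_mul, zero_mul, Finset.sum_ite_eq, Finset.mem_univ, if_true, J.dy_comm, mul_comm]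
  ring

/-- The Bianchi identity relating the Riemann and Berwald curvatures. -/
lemma dy_dy_curvature (i j k l m : Fin n) :
    J.dy m (J.dy j (J.hor G k (J.dy l (G i)) - J.hor G l (J.dy k (G i)))) =
      J.hor13 G (J.berwald G) i j m l k - J.hor13 G (J.berwald G) i j m k l := by
  simp only [hor13, berwald, hor_apply, map_sub, map_add, map_sum, Derivation.leibniz, smul_eq_mul,
    J.dx_dy, Finset.sum_add_distrib, J.dy_comm, mul_comm]
  ring

/-- The Euler (Liouville) derivation `yʳ ∂/∂yʳ`. -/
def euler : Derivation ℝ A A := ∑ r, J.v r • J.dy r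

lemma euler_apply (a : A) : J.euler a = ∑ r, J.v r * J.dy r a := by
  simp only [euler, ← Derivation.coeFnAddMonoidHom_apply, map_sum, Finset.sum_apply]
  rfl

lemma euler_dy (j : Fin n) (a : A) : J.euler (J.dy j a) = J.dy j (J.euler a) - J.dy j a := by
  simp only [euler_apply, map_sum, Derivation.leibniz, smul_eq_mul, J.dy_v, Finset.sum_add_distrib,
    mul_ite, mul_one, mul_zero, Finset.sum_ite_eq, Finset.mem_univ, if_true, J.dy_comm j]
  ring

lemma euler_dx (j : Fin n) (a : A) : J.euler (J.dx j a) = J.dx j (J.euler a) := by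
  simp only [euler_apply, map_sum, Derivation.leibniz, smul_eq_mul, J.dx_v, mul_zero, add_zero,
    J.dx_dy]

lemma euler_v (j : Fin n) : J.euler (J.v j) = J.v j := by
  simp [euler_apply, J.dy_v]

/-- `G` is the geodesic spray of the Finsler metric whose square is `Φ`. -/
structure IsSpray (Φ : A) (G : Fin n → A) : Prop where
  isUnit : IsUnit Φ
  euler : J.euler Φ = 2 * Φ
  nondegenerate : ∀ X : Fin n → A, (∀ l, ∑ i, X i * J.dy i (J.dy l Φ) = 0) → ∀ i, X i = 0
  spray : ∀ l, 2 * ∑ i, G i * J.dy i (J.dy l Φ) = (∑ k, J.v k * J.dx k (J.dy l Φ)) - J.dx l Φ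

namespace IsSpray

variable {J G} {Φ : A} (h : J.IsSpray Φ G)

include h

lemma euler_dy_sq (j : Fin n) : J.euler (J.dy j Φ) = J.dy j Φ := by
  rw [J.euler_dy, h.euler, Derivation.leibniz, map_two]
  simp only [smul_eq_mul]; ring

lemma euler_dy_dy_sq (j k : Fin n) : J.euler (J.dy j (J.dy k Φ)) = 0 := by
  rw [J.euler_dy, h.euler_dy_sq, sub_self]

/-- The spray coefficients are homogeneous of degree two. -/
lemma euler_spray (i : Fin n) : J.euler (G i) = 2 * G i := by
  rw [← sub_eq_zero]
  refine h.nondegenerate (fun i => J.euler (G i) - 2 * G i) (fun l => ?_) i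
  have key := congrArg J.euler (h.spray l)
  simp only [Derivation.leibniz, map_two, map_sum, map_sub, smul_eq_mul, h.euler_dy_dy_sq, J.euler_dx,
    J.euler_v, h.euler_dy_sq, h.euler, mul_zero, add_zero, zero_add, Finset.sum_add_distrib] at key
  have := h.spray l
  have h1 : ∑ i, J.dx i (J.dy l Φ) * J.v i = ∑ i, J.v i * J.dx i (J.dy l Φ) :=
    Finset.sum_congr rfl fun _ _ => mul_comm _ _
  have h2 : ∑ i, J.dy i (J.dy l Φ) * J.euler (G i) = ∑ i, J.euler (G i) * J.dy i (J.dy l Φ) :=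
    Finset.sum_congr rfl fun _ _ => mul_comm _ _
  refine (isUnit_natCast (A := A) two_ne_zero).mul_left_cancel ?_
  simp only [sub_mul, Finset.sum_sub_distrib, mul_assoc, ← Finset.mul_sum]
  linear_combination key - 2 * this + h1 - 2 * h2

lemma euler_connection (i j : Fin n) : J.euler (J.dy j (G i)) = J.dy j (G i) := by
  rw [J.euler_dy, h.euler_spray, Derivation.leibniz, map_two]
  simp only [smul_eq_mul]; ring

lemma euler_dy_connection (i j k : Fin n) : J.euler (J.dy j (J.dy k (G i))) = 0 := by
  rw [J.euler_dy, h.euler_connection, sub_self]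

lemma euler_berwald (i j k l : Fin n) :
    J.euler (J.berwald G i j k l) = - J.berwald G i j k l := by
  rw [berwald, J.euler_dy, h.euler_dy_connection, map_zero, zero_sub]

/-- The metric is constant along horizontal directions. -/
lemma hor_sq (m : Fin n) : J.hor G m Φ = 0 := by
  have key : 2 * ∑ i, G i * J.dy i Φ = ∑ k, J.v k * J.dx k Φ := by
    have e : ∑ l, J.v l * (2 * ∑ i, G i * J.dy i (J.dy l Φ)) =
        ∑ l, J.v l * ((∑ k, J.v k * J.dx k (J.dy l Φ)) - J.dx l Φ) :=
      Finset.sum_congr rfl fun l _ => by rw [h.spray l]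
    have e1 : ∑ l, J.v l * (2 * ∑ i, G i * J.dy i (J.dy l Φ)) = 2 * ∑ i, G i * J.dy i Φ := by
      simp only [Finset.mul_sum]
      rw [Finset.sum_comm]
      refine Finset.sum_congr rfl fun i _ => ?_
      rw [← h.euler_dy_sq i, J.euler_apply]
      simp only [Finset.mul_sum]
      exact Finset.sum_congr rfl fun l _ => by rw [J.dy_comm l i]; ring
    have e2 : ∑ l, J.v l * (∑ k, J.v k * J.dx k (J.dy l Φ)) = 2 * ∑ k, J.v k * J.dx k Φ := by
      simp only [Finset.mul_sum]
      rw [Finset.sum_comm]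
      refine Finset.sum_congr rfl fun i _ => ?_
      have : 2 * J.dx i Φ = J.euler (J.dx i Φ) := by
        rw [J.euler_dx, h.euler, Derivation.leibniz, map_two]; simp
      rw [mul_left_comm, this, J.euler_apply, Finset.mul_sum]
      exact Finset.sum_congr rfl fun l _ => by rw [J.dx_dy]; ring
    simp only [mul_sub, Finset.sum_sub_distrib] at e
    linear_combination e - e1 + e2
  have d := congrArg (J.dy m) key
  simp only [Derivation.leibniz, map_two, map_sum, smul_eq_mul, J.dy_v, Finset.sum_add_distrib,
    mul_zero, add_zero, mul_ite, mul_one, Finset.sum_ite_eq, Finset.mem_univ, if_true] at d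
  have s := h.spray m
  have h1 : ∑ i, J.dy i Φ * J.dy m (G i) = ∑ i, J.dy m (G i) * J.dy i Φ :=
    Finset.sum_congr rfl fun _ _ => mul_comm _ _
  simp only [J.dx_dy, J.dy_comm _ m] at s
  rw [hor_apply]
  refine (isUnit_natCast (A := A) two_ne_zero).mul_left_cancel ?_
  linear_combination s - d + 2 * h1

/-- `y_j` is horizontally constant. -/
lemma hor1_dy_sq (j m : Fin n) : J.hor1 G (fun j => J.dy j Φ) j m = 0 := by
  have e := congrArg (J.dy j) (h.hor_sq m)
  simp only [hor_apply, Derivation.leibniz, map_zero, map_sub, map_sum, smul_eq_mul,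
    Finset.sum_add_distrib] at e
  simp only [hor1, hor_apply, J.dx_dy, J.dy_comm _ j] at e ⊢
  linear_combination e

/-- The Landsberg curvature is the contraction of the Berwald curvature with `y_i`. -/
lemma landsberg (j k l : Fin n) :
    ∑ m, J.hor3 G (fun i j k => J.dy i (J.dy j (J.dy k Φ))) j k l m * J.v m =
      - ∑ i, J.berwald G i j k l * J.dy i Φ := by
  have e : ∀ m, J.hor3 G (fun i j k => J.dy i (J.dy j (J.dy k Φ))) j k l m =
      ∑ i, (J.dy m (J.berwald G i j k l) * J.dy i Φ + J.berwald G i j k m * J.dy i (J.dy l Φ) +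
        J.berwald G i j l m * J.dy i (J.dy k Φ) + J.berwald G i k l m * J.dy i (J.dy j Φ)) := by
    intro m
    have e := congrArg (J.dy j) (congrArg (J.dy k) (congrArg (J.dy l) (h.hor_sq m)))
    simp only [hor_apply, Derivation.leibniz, map_zero, map_add, map_sub, map_sum, smul_eq_mul,
      Finset.sum_add_distrib, mul_comm] at e
    simp only [hor3, hor_apply, berwald, Finset.sum_add_distrib, J.dx_dy, J.dy_comm, mul_comm]
    linear_combination e
  have z : ∀ i j k, ∑ m, J.berwald G i j k m * J.v m = 0 := by
    intro i j k
    rw [← h.euler_dy_connection i j k, J.euler_apply]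
    exact Finset.sum_congr rfl fun m _ => by simp only [berwald, J.dy_comm]; ring
  have w : ∀ i, ∑ m, J.dy m (J.berwald G i j k l) * J.v m = - J.berwald G i j k l := by
    intro i
    rw [← h.euler_berwald, J.euler_apply]
    exact Finset.sum_congr rfl fun m _ => mul_comm _ _
  simp only [e, Finset.sum_mul]
  rw [Finset.sum_comm, ← Finset.sum_neg_distrib]
  refine Finset.sum_congr rfl fun i _ => ?_
  have : ∀ m, (J.dy m (J.berwald G i j k l) * J.dy i Φ + J.berwald G i j k m * J.dy i (J.dy l Φ) +
      J.berwald G i j l m * J.dy i (J.dy k Φ) + J.berwald G i k l m * J.dy i (J.dy j Φ)) * J.v m =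
      J.dy i Φ * (J.dy m (J.berwald G i j k l) * J.v m) +
      J.dy i (J.dy l Φ) * (J.berwald G i j k m * J.v m) +
      J.dy i (J.dy k Φ) * (J.berwald G i j l m * J.v m) +
      J.dy i (J.dy j Φ) * (J.berwald G i k l m * J.v m) := fun m => by ring
  simp only [this, Finset.sum_add_distrib, ← Finset.mul_sum, z, w]
  ring

end IsSpray

end FiberCalculus
end

noncomputable section
namespace FiberCalculus
variable {n : ℕ} {A : Type*} [CommRing A] [Algebra ℝ A] {J : FiberCalculus n A} {G : Fin n → A}

namespace IsSpray

variable {Φ : A} (h : J.IsSpray Φ G)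

include h in
lemma hor13_of_decomp {w : Fin n → Fin n → Fin n → A} {e : Fin n → Fin n → A}
    (hB : ∀ i j k l, J.berwald G i j k l = J.v i * w j k l + (if i = j then e k l else 0) +
      (if i = k then e j l else 0) + (if i = l then e j k else 0)) (i j k l m : Fin n) :
    J.hor13 G (J.berwald G) i j k l m = J.v i * J.hor3 G w j k l m +
      (if i = j then J.hor2 G e k l m else 0) + (if i = k then J.hor2 G e j l m else 0) +
      (if i = l then J.hor2 G e j k m else 0) := by
  have hv : J.hor G m (J.v i) = - J.dy m (G i) := by
    simp [hor_apply, J.dx_v, J.dy_v]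
  have hc : ∑ r, J.v r * J.dy r (J.dy m (G i)) = J.dy m (G i) := by
    rw [← J.euler_apply, h.euler_connection]
  have hm : ∀ a : A, ∑ r, J.v r * (a * J.dy r (J.dy m (G i))) = a * J.dy m (G i) := fun a => by
    refine Eq.trans ?_ (congrArg (a * ·) hc)
    simp only [Finset.mul_sum]
    exact Finset.sum_congr rfl fun _ _ => by ring
  have hi : ∀ (p : Prop) [Decidable p] (a : A),
      J.hor G m (if p then a else 0) = if p then J.hor G m a else 0 := fun p _ a => by
    split_ifs <;> simp
  simp only [hor13, hB, add_mul, Finset.sum_add_distrib, map_add, hi, Derivation.leibniz,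
    smul_eq_mul, hv, hm, hor2, hor3, ite_mul, zero_mul, Finset.sum_ite_eq, Finset.sum_ite_eq',
    Finset.mem_univ, if_true, mul_assoc, ← Finset.mul_sum]
  have hs : ∀ (p : Prop) [Decidable p] (f : Fin n → A),
      (∑ r, if p then f r else 0) = if p then ∑ r, f r else 0 := fun p _ f => by
    split_ifs <;> simp
  simp only [hs]
  split_ifs <;> ring

end IsSpray

lemma hor3_of_parallel {Φ : A} {p : Fin n → A} {w : Fin n → Fin n → Fin n → A}
    {e : Fin n → Fin n → A} {m : Fin n} (hΦ : J.hor G m Φ = 0) (hp : ∀ j, J.hor1 G p j m = 0)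
    (j k l : Fin n) :
    J.hor3 G (fun j k l => -(2 * (Φ * w j k l) + p j * e k l + p k * e j l + p l * e j k))
        j k l m =
      -(2 * (Φ * J.hor3 G w j k l m) + p j * J.hor2 G e k l m + p k * J.hor2 G e j l m
        + p l * J.hor2 G e j k m) := by
  have hp' : ∀ j, J.hor G m (p j) = ∑ r, p r * J.dy j (J.dy m (G r)) := fun j =>
    sub_eq_zero.1 (hp j)
  have c : ∀ (a : A) (g : Fin n → A), ∑ r, p r * (a * g r) = a * ∑ r, p r * g r := fun a g => by
    rw [Finset.mul_sum]; exact Finset.sum_congr rfl fun _ _ => by ring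
  simp only [hor3, hor2, map_neg, map_add, Derivation.leibniz, smul_eq_mul, map_two, hΦ, hp',
    neg_mul, add_mul, Finset.sum_neg_distrib, Finset.sum_add_distrib, mul_assoc, ← Finset.mul_sum]
  simp only [c]
  ring

lemma hor2_symm {e : Fin n → Fin n → A} (hs : ∀ j k, e j k = e k j) (j k m : Fin n) :
    J.hor2 G e j k m = J.hor2 G e k j m := by
  have he : e = fun j k => e k j := funext fun j => funext fun k => hs j k
  conv_lhs => rw [he]
  simp only [hor2]
  ring

lemma IsSpray.hor2_contract {Φ : A} (h : J.IsSpray Φ G) {e : Fin n → Fin n → A}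
    (he : ∀ j, ∑ k, e j k * J.v k = 0) (j m : Fin n) : ∑ k, J.hor2 G e j k m * J.v k = 0 := by
  have hv : ∀ i, J.hor G m (J.v i) = - J.dy m (G i) := fun i => by
    simp [hor_apply, J.dx_v, J.dy_v]
  have d := congrArg (J.hor G m) (he j)
  simp only [map_sum, Derivation.leibniz, smul_eq_mul, hv, map_zero, Finset.sum_add_distrib,
    mul_neg, Finset.sum_neg_distrib] at d
  have h1 : ∑ k, (∑ r, e r k * J.dy j (J.dy m (G r))) * J.v k = 0 := by
    simp only [Finset.sum_mul]
    rw [Finset.sum_comm]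
    refine Finset.sum_eq_zero fun r _ => ?_
    rw [← mul_zero (J.dy j (J.dy m (G r))), ← he r, Finset.mul_sum]
    exact Finset.sum_congr rfl fun _ _ => by ring
  have h2 : ∑ k, (∑ r, e j r * J.dy k (J.dy m (G r))) * J.v k = ∑ r, e j r * J.dy m (G r) := by
    simp only [Finset.sum_mul]
    rw [Finset.sum_comm]
    refine Finset.sum_congr rfl fun r _ => ?_
    refine Eq.trans ?_ (congrArg (e j r * ·) (h.euler_connection r m))
    simp only [J.euler_apply, Finset.mul_sum]
    exact Finset.sum_congr rfl fun _ _ => by ring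
  simp only [hor2, sub_mul, Finset.sum_sub_distrib, h1, h2]
  have h3 : ∑ k, J.hor G m (e j k) * J.v k = ∑ k, J.v k * J.hor G m (e j k) :=
    Finset.sum_congr rfl fun _ _ => mul_comm _ _
  linear_combination d + h3

/-- An algebraic fact about `(1,3)`-tensors: the transverse part of an antisymmetrised
derivative vanishes only if the derivative itself does. -/
lemma eq_zero_of_antisymm_decomp (hn : 2 < n) {Φ : A} {v p : Fin n → A} (hΦ : IsUnit Φ)
    (hvp : ∑ i, p i * v i = 2 * Φ) {W : Fin n → Fin n → Fin n → Fin n → A}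
    {E : Fin n → Fin n → Fin n → A} (hs : ∀ j k m, E j k m = E k j m)
    (he : ∀ j m, ∑ k, E j k m * v k = 0)
    (hW : ∀ i j k l m, v i * (W j k l m - W j k m l) +
      (if i = j then E k l m - E k m l else 0) + (if i = k then E j l m - E j m l else 0) +
      (if i = l then E j k m else 0) - (if i = m then E j k l else 0) = 0) (j k m : Fin n) :
    E j k m = 0 := by
  have cancel : ∀ a b : A, (∀ i, v i * a + v i * b = 0) → a + b = 0 := fun a b hab => by
    have u : IsUnit (2 * Φ) := (isUnit_natCast (A := A) two_ne_zero).mul hΦ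
    refine u.mul_left_cancel ?_
    rw [← hvp, mul_zero, Finset.sum_mul, ← Finset.sum_const_zero]
    exact Finset.sum_congr rfl fun i _ => by linear_combination p i * hab i
  have he' : ∀ k m, ∑ j, E j k m * v j = 0 := fun k m => by
    rw [← he k m]; exact Finset.sum_congr rfl fun j _ => by rw [hs]
  have hs1 : ∀ (p : Prop) [Decidable p] (f : Fin n → A),
      (∑ r, if p then f r else 0) = if p then ∑ r, f r else 0 := fun p _ f => by
    split_ifs <;> simp
  have c1 : ∀ k l m, (∑ j, (W j k l m - W j k m l) * v j) + (E k l m - E k m l) = 0 := by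
    intro k l m
    refine cancel _ _ fun i => ?_
    have := Finset.sum_congr (rfl : (Finset.univ : Finset (Fin n)) = _)
      (fun j _ => congrArg (· * v j) (hW i j k l m))
    simp only [add_mul, sub_mul, ite_mul, zero_mul, Finset.sum_add_distrib, Finset.sum_sub_distrib,
      hs1, he', Finset.sum_ite_eq, Finset.mem_univ, if_true, Finset.sum_const_zero, mul_assoc,
      ite_self, ← Finset.mul_sum, mul_sub, sub_zero, add_zero] at this ⊢
    linear_combination this
  have t1 : ∀ k l m, (∑ j, (W j k l m - W j k m l) * v j) + (n + 2) * (E k l m - E k m l) = 0 := by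
    intro k l m
    have := Finset.sum_congr (rfl : (Finset.univ : Finset (Fin n)) = _) (fun j _ => hW j j k l m)
    simp only [Finset.sum_add_distrib, Finset.sum_sub_distrib, Finset.sum_ite_eq',
      Finset.mem_univ, if_true, Finset.sum_const_zero, Finset.sum_const, Finset.card_univ,
      Fintype.card_fin, nsmul_eq_mul, mul_comm (v _), hs _ k] at this ⊢
    linear_combination this
  have sym : ∀ k l m, E k l m = E k m l := by
    intro k l m
    refine (isUnit_natCast (A := A) n.succ_ne_zero).mul_left_cancel ?_
    push_cast
    linear_combination t1 k l m - c1 k l m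
  have c2 : (∑ l, (W j k l m - W j k m l) * v l) + E j k m = 0 := by
    refine cancel _ _ fun i => ?_
    have := Finset.sum_congr (rfl : (Finset.univ : Finset (Fin n)) = _)
      (fun l _ => congrArg (· * v l) (hW i j k l m))
    simp only [add_mul, sub_mul, ite_mul, zero_mul, Finset.sum_add_distrib, Finset.sum_sub_distrib,
      hs1, Finset.sum_ite_eq, Finset.mem_univ, if_true, Finset.sum_const_zero, mul_assoc,
      ite_self, ← Finset.mul_sum, mul_sub, sub_zero, add_zero, sym _ _ m, sub_self, sym j k, he]
      at this ⊢
    linear_combination this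
  have t2 : (∑ l, (W j k l m - W j k m l) * v l) + (n - 1) * E j k m = 0 := by
    have := Finset.sum_congr (rfl : (Finset.univ : Finset (Fin n)) = _) (fun l _ => hW l j k l m)
    simp only [Finset.sum_add_distrib, Finset.sum_sub_distrib, Finset.sum_ite_eq',
      Finset.mem_univ, if_true, Finset.sum_const_zero, Finset.sum_const, Finset.card_univ,
      Fintype.card_fin, nsmul_eq_mul, mul_comm (v _), sym _ _ m, sub_self, ite_self] at this ⊢
    linear_combination this
  obtain ⟨d, rfl⟩ := Nat.exists_eq_add_of_lt hn
  refine (isUnit_natCast (A := A) d.succ_ne_zero).mul_left_cancel ?_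
  push_cast at t2 ⊢
  linear_combination t2 - c2

/-- The algebraic core: for a Berwald curvature whose transverse part is built from a symmetric
tensor `e`, the full symmetry of its horizontal derivative decomposes into the stretch
condition and parallelism of `e`. -/
theorem IsSpray.berwald_symm_iff (hn : 2 < n) {Φ : A} (h : J.IsSpray Φ G)
    {w : Fin n → Fin n → Fin n → A} {e : Fin n → Fin n → A} (hs : ∀ j k, e j k = e k j)
    (he : ∀ j, ∑ k, e j k * J.v k = 0)
    (hB : ∀ i j k l, J.berwald G i j k l = J.v i * w j k l + (if i = j then e k l else 0) +
      (if i = k then e j l else 0) + (if i = l then e j k else 0))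
    {L : Fin n → Fin n → Fin n → A}
    (hL : ∀ j k l, L j k l =
      ∑ m, J.hor3 G (fun i j k => J.dy i (J.dy j (J.dy k Φ))) j k l m * J.v m) :
    (∀ i j k l m, J.hor13 G (J.berwald G) i j m l k - J.hor13 G (J.berwald G) i j m k l = 0) ↔
      (∀ i j k l, J.hor3 G L i j k l - J.hor3 G L i j l k = 0) ∧
      ∀ j k l, J.hor2 G e j k l = 0 := by
  have hvp : ∑ i, J.dy i Φ * J.v i = 2 * Φ := by
    rw [← h.euler, J.euler_apply]; exact Finset.sum_congr rfl fun _ _ => mul_comm _ _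
  have hL' : L = fun j k l =>
      -(2 * (Φ * w j k l) + J.dy j Φ * e k l + J.dy k Φ * e j l + J.dy l Φ * e j k) := by
    funext j k l
    rw [hL, h.landsberg]
    simp only [hB, add_mul, ite_mul, zero_mul, Finset.sum_add_distrib, Finset.sum_ite_eq',
      Finset.mem_univ, if_true]
    have : ∑ i, J.v i * w j k l * J.dy i Φ = 2 * Φ * w j k l := by
      rw [← hvp, Finset.sum_mul]; exact Finset.sum_congr rfl fun _ _ => by ring
    rw [this]; ring
  have hL3 : ∀ j k l m, J.hor3 G L j k l m =
      -(2 * (Φ * J.hor3 G w j k l m) + J.dy j Φ * J.hor2 G e k l m + J.dy k Φ * J.hor2 G e j l m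
        + J.dy l Φ * J.hor2 G e j k m) := fun j k l m => by
    rw [hL']
    exact hor3_of_parallel (w := w) (e := e) (h.hor_sq m) (fun j => h.hor1_dy_sq j m) j k l
  simp only [h.hor13_of_decomp hB, hL3]
  constructor
  · intro H
    have E0 : ∀ j k m, J.hor2 G e j k m = 0 :=
      eq_zero_of_antisymm_decomp hn h.isUnit hvp (W := J.hor3 G w) (hor2_symm hs)
        (h.hor2_contract he) fun i j k l m => by
          have := H i j m l k
          split_ifs at this ⊢ <;> linear_combination this
    refine ⟨fun j k l m => ?_, E0⟩
    have hw : J.hor3 G w j k l m - J.hor3 G w j k m l = 0 := by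
      refine ((isUnit_natCast (A := A) two_ne_zero).mul h.isUnit).mul_left_cancel ?_
      have : ∀ i, J.v i * (J.hor3 G w j k l m - J.hor3 G w j k m l) = 0 := fun i => by
        have := H i j m l k
        simp only [E0, ite_self, add_zero] at this
        linear_combination this
      rw [Nat.cast_ofNat, ← hvp, mul_zero, Finset.sum_mul]
      exact Finset.sum_eq_zero fun i _ => by rw [mul_assoc, this, mul_zero]
    simp only [E0]
    linear_combination (-2 * Φ) * hw
  · rintro ⟨H, E0⟩ i j k l m
    have hw : J.hor3 G w j m l k - J.hor3 G w j m k l = 0 := by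
      refine ((isUnit_natCast (A := A) two_ne_zero).mul h.isUnit).mul_left_cancel ?_
      have := H j m l k
      simp only [E0] at this
      push_cast
      linear_combination -this
    simp only [E0, ite_self, add_zero]
    linear_combination J.v i * hw

end FiberCalculus
end

noncomputable section
namespace FiberCalculus
variable {n : ℕ} {A : Type*} [CommRing A] [Algebra ℝ A] (J : FiberCalculus n A)

/-- Fundamental tensor. -/
def fund (Φ : A) (i j : Fin n) : A := (1 / 2 : ℝ) • J.dy i (J.dy j Φ)

/-- The covector `y_i`. -/
def low (Φ : A) (i : Fin n) : A := ∑ j, J.fund Φ i j * J.v j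

/-- Cartan torsion. -/
def cartan (Φ : A) (i j k : Fin n) : A := (1 / 4 : ℝ) • J.dy i (J.dy j (J.dy k Φ))

/-- Angular metric, `u` standing for `1 / F`. -/
def ang (Φ u : A) (i j : Fin n) : A := J.fund Φ i j - J.low Φ i * J.low Φ j * u ^ 2

/-- Angular projection, `u` standing for `1 / F`. -/
def proj (Φ u : A) (i j : Fin n) : A := (if i = j then 1 else 0) - J.v i * J.low Φ j * u ^ 2

/-- Spray coefficients. -/
def sprayCoeff (Φ : A) (i : Fin n) : A :=
  (1 / 4 : ℝ) • ∑ l, (Matrix.of (J.fund Φ))⁻¹ i l *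
    ((∑ k, J.v k * J.dx k (J.dy l Φ)) - J.dx l Φ)

/-- Mean Berwald curvature. -/
def meanBerwald (G : Fin n → A) (j k : Fin n) : A := (1 / 2 : ℝ) • ∑ m, J.berwald G m j k m

/-- Landsberg curvature. -/
def land (Φ : A) (G : Fin n → A) (i j k : Fin n) : A :=
  ∑ m, J.hor3 G (J.cartan Φ) i j k m * J.v m

/-- The curvature tensor `Rⁱ_{jkl}`. -/
def riem4 (G : Fin n → A) (i j k l : Fin n) : A :=
  (1 / 3 : ℝ) • J.dy j (J.dy l (J.riem G i k) - J.dy k (J.riem G i l))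

lemma fund_comm (Φ : A) (i j : Fin n) : J.fund Φ i j = J.fund Φ j i := by
  rw [fund, fund, J.dy_comm]

lemma isSpray_sprayCoeff {Φ : A} (hu : IsUnit Φ) (hE : J.euler Φ = 2 * Φ)
    (hdet : IsUnit (Matrix.of (J.fund Φ)).det) : J.IsSpray Φ (J.sprayCoeff Φ) := by
  have hM : ∀ (X : Fin n → A) l, ∑ i, X i * J.dy i (J.dy l Φ) =
      2 * Matrix.vecMul X (Matrix.of (J.fund Φ)) l := by
    intro X l
    simp only [Matrix.vecMul, dotProduct, Matrix.of_apply, fund, Finset.mul_sum]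
    refine Finset.sum_congr rfl fun i _ => ?_
    rw [mul_left_comm, two_mul ((1 / 2 : ℝ) • _), ← add_smul]
    norm_num
  have hMt : (Matrix.of (J.fund Φ)).transpose = Matrix.of (J.fund Φ) := by
    ext i j
    exact J.fund_comm Φ j i
  refine ⟨hu, hE, fun X hX => ?_, fun l => ?_⟩
  · have h0 : Matrix.vecMul X (Matrix.of (J.fund Φ)) = 0 := funext fun l => by
      refine (isUnit_natCast (A := A) two_ne_zero).mul_left_cancel ?_
      rw [Nat.cast_ofNat, ← hM, hX, Pi.zero_apply, mul_zero]
    have h1 : X = 0 := by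
      rw [← Matrix.vecMul_one X, ← Matrix.mul_nonsing_inv _ hdet, ← Matrix.vecMul_vecMul, h0,
        Matrix.zero_vecMul]
    exact fun i => congrFun h1 i
  · have hG : J.sprayCoeff Φ = (1 / 4 : ℝ) • Matrix.mulVec (Matrix.of (J.fund Φ))⁻¹
        (fun l => (∑ k, J.v k * J.dx k (J.dy l Φ)) - J.dx l Φ) := rfl
    rw [hM, ← Matrix.mulVec_transpose, hMt, hG, Matrix.mulVec_smul, Matrix.mulVec_mulVec,
      Matrix.mul_nonsing_inv _ hdet, Matrix.one_mulVec, Pi.smul_apply, two_mul, two_mul, ← add_smul,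
      ← add_smul]
    norm_num

lemma hor3_smul (G : Fin n → A) (c : ℝ) (T : Fin n → Fin n → Fin n → A) (i j k m : Fin n) :
    J.hor3 G (fun i j k => c • T i j k) i j k m = c • J.hor3 G T i j k m := by
  simp only [hor3, Derivation.map_smul, smul_mul_assoc, ← Finset.smul_sum, smul_sub]

lemma hor2_smul (G : Fin n → A) (c : ℝ) (T : Fin n → Fin n → A) (j k m : Fin n) :
    J.hor2 G (fun j k => c • T j k) j k m = c • J.hor2 G T j k m := by
  simp only [hor2, Derivation.map_smul, smul_mul_assoc, ← Finset.smul_sum, smul_sub]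

variable {J}

section
variable {Φ : A} {G : Fin n → A} (h : J.IsSpray Φ G)
include h

lemma IsSpray.low_eq (j : Fin n) : J.low Φ j = (1 / 2 : ℝ) • J.dy j Φ := by
  rw [← h.euler_dy_sq j, J.euler_apply, Finset.smul_sum]
  refine Finset.sum_congr rfl fun k _ => ?_
  rw [fund, J.dy_comm, smul_mul_assoc, mul_comm]

lemma IsSpray.low_contract : ∑ j, J.low Φ j * J.v j = Φ := by
  have : ∑ j, J.dy j Φ * J.v j = (2 : ℝ) • Φ := by
    rw [Algebra.smul_def, map_ofNat, ← h.euler, J.euler_apply]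
    exact Finset.sum_congr rfl fun _ _ => mul_comm _ _
  simp only [h.low_eq, smul_mul_assoc, ← Finset.smul_sum, this, smul_smul]
  norm_num

lemma IsSpray.cartan_contract (j k : Fin n) : ∑ m, J.cartan Φ j k m * J.v m = 0 := by
  have : ∑ m, J.dy j (J.dy k (J.dy m Φ)) * J.v m = 0 := by
    rw [← h.euler_dy_dy_sq j k, J.euler_apply]
    exact Finset.sum_congr rfl fun m _ => by rw [J.dy_comm k m, J.dy_comm j m, mul_comm]
  simp only [cartan, smul_mul_assoc, ← Finset.smul_sum, this, smul_zero]

lemma IsSpray.ang_contract {u : A} (hu : u ^ 2 * Φ = 1) (j : Fin n) :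
    ∑ k, J.ang Φ u j k * J.v k = 0 := by
  have : ∀ k, J.low Φ j * J.low Φ k * u ^ 2 * J.v k = J.low Φ j * u ^ 2 * (J.low Φ k * J.v k) :=
    fun k => by ring
  simp only [ang, sub_mul, Finset.sum_sub_distrib, this, ← Finset.mul_sum, h.low_contract]
  rw [← low]
  linear_combination (-J.low Φ j) * hu

/-- The algebraic form of the equivalence for generalized isotropic Berwald sprays. -/
theorem IsSpray.gib_iff (hn : 2 < n) {u μ lam : A} (hu : u ^ 2 * Φ = 1)
    (hB : ∀ i j k l, J.berwald G i j k l = μ * J.cartan Φ j k l * (J.v i * u) +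
      lam * (J.proj Φ u i j * J.ang Φ u k l + J.proj Φ u i k * J.ang Φ u j l +
        J.proj Φ u i l * J.ang Φ u j k)) :
    (∀ i j k l m, J.dy m (J.riem4 G i j k l) = 0) ↔
      (∀ i j k l, 2 * (J.hor3 G (J.land Φ G) i j k l - J.hor3 G (J.land Φ G) i j l k) = 0) ∧
      ∀ j k l, J.hor2 G (J.meanBerwald G) j k l = 0 := by
  set e : Fin n → Fin n → A := fun j k => lam * J.ang Φ u j k with hedef
  set w : Fin n → Fin n → Fin n → A := fun j k l => μ * J.cartan Φ j k l * u -
    u ^ 2 * (J.low Φ j * e k l + J.low Φ k * e j l + J.low Φ l * e j k) with hwdef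
  have hs : ∀ j k, e j k = e k j := fun j k => by
    simp only [hedef, ang, J.fund_comm Φ j k]; ring
  have he : ∀ j, ∑ k, e j k * J.v k = 0 := fun j => by
    simp only [hedef, mul_assoc, ← Finset.mul_sum, h.ang_contract hu, mul_zero]
  have hd : ∀ i j k l, J.berwald G i j k l = J.v i * w j k l + (if i = j then e k l else 0) +
      (if i = k then e j l else 0) + (if i = l then e j k else 0) := fun i j k l => by
    have hp : ∀ (p : Prop) [Decidable p] (a : A), (if p then a else 0) = (if p then 1 else 0) * a :=
      fun p _ a => by simp
    rw [hB, hp _ (e k l), hp _ (e j l), hp _ (e j k)]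
    simp only [hwdef, hedef, proj]
    ring
  have hE : J.meanBerwald G = fun j k => (((n : ℝ) + 1) / 2) • e j k := by
    funext j k
    have c1 : ∀ m, J.v m * w j k m = μ * u * (J.cartan Φ j k m * J.v m) -
        u ^ 2 * (J.low Φ j * (e k m * J.v m) + J.low Φ k * (e j m * J.v m) +
          e j k * (J.low Φ m * J.v m)) := fun m => by simp only [hwdef]; ring
    have c2 : ∑ m, J.v m * w j k m = - e j k := by
      simp only [c1, Finset.sum_sub_distrib, ← Finset.mul_sum, Finset.sum_add_distrib, he,
        h.cartan_contract, h.low_contract]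
      linear_combination (- e j k) * hu
    have : ∑ m, J.berwald G m j k m = ((n : ℝ) + 1) • e j k := by
      simp only [hd, Finset.sum_add_distrib, c2, Finset.sum_ite_eq', Finset.mem_univ, if_true,
        Finset.sum_const, Finset.card_univ, Fintype.card_fin, nsmul_eq_mul, hs k j]
      rw [Algebra.smul_def, map_add, map_natCast, map_one]
      ring
    rw [meanBerwald, this, smul_smul]
    ring_nf
  have key := h.berwald_symm_iff hn hs he hd
    (L := fun j k l => (4 : ℝ) • J.land Φ G j k l) (fun j k l => by
      rw [land, Finset.smul_sum]
      refine Finset.sum_congr rfl fun m _ => ?_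
      have : J.cartan Φ = fun i j k => (1 / 4 : ℝ) • J.dy i (J.dy j (J.dy k Φ)) := rfl
      rw [this, hor3_smul, smul_mul_assoc, smul_smul]
      norm_num)
  have hR : ∀ i j k l m, J.dy m (J.riem4 G i j k l) =
      J.hor13 G (J.berwald G) i j m l k - J.hor13 G (J.berwald G) i j m k l := by
    intro i j k l m
    have t : ∀ a : A, 3 * a = (3 : ℝ) • a := fun a => by rw [Algebra.smul_def, map_ofNat]
    rw [riem4, J.dy_riem_sub, t]
    simp only [Derivation.map_smul, smul_smul]
    rw [J.dy_dy_curvature]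
    norm_num
  have c4 : (4 : ℝ) ≠ 0 := by norm_num
  have cn : ((n : ℝ) + 1) / 2 ≠ 0 := by positivity
  simp only [hR, hE, hor2_smul, smul_eq_zero_iff_right cn]
  rw [key]
  refine and_congr_left fun _ => ?_
  refine forall_congr' fun i => forall_congr' fun j => forall_congr' fun k => forall_congr' fun l => ?_
  rw [hor3_smul, hor3_smul, ← smul_sub, smul_eq_zero_iff_right c4, ← Nat.cast_ofNat,
    (isUnit_natCast (A := A) two_ne_zero).mul_right_eq_zero]

end

end FiberCalculus
end

noncomputable section

open scoped ContDiff

section SmoothAlgebra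

variable {E : Type*} [NormedAddCommGroup E] [NormedSpace ℝ E]

/-- The algebra of functions on `D` that are restrictions of functions smooth on `D`. -/
def smoothAlgebra (D : Set E) : Subalgebra ℝ (D → ℝ) where
  carrier := {a | ∃ f : E → ℝ, ContDiffOn ℝ ∞ f D ∧ ∀ p : D, f p = a p}
  mul_mem' := by
    rintro a b ⟨f, hf, hfa⟩ ⟨g, hg, hgb⟩
    exact ⟨fun p => f p * g p, hf.mul hg, fun p => by simp [hfa, hgb]⟩
  add_mem' := by
    rintro a b ⟨f, hf, hfa⟩ ⟨g, hg, hgb⟩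
    exact ⟨fun p => f p + g p, hf.add hg, fun p => by simp [hfa, hgb]⟩
  algebraMap_mem' r := ⟨fun _ => r, contDiffOn_const, fun _ => rfl⟩

variable {D : Set E}

/-- A function representing an element of the smooth algebra. -/
def smoothExt (a : smoothAlgebra D) : E → ℝ := a.2.choose

lemma contDiffOn_smoothExt (a : smoothAlgebra D) : ContDiffOn ℝ ∞ (smoothExt a) D :=
  a.2.choose_spec.1

lemma smoothExt_apply (a : smoothAlgebra D) (p : D) : smoothExt a p = a.1 p :=
  a.2.choose_spec.2 p

lemma fderiv_smoothExt (hD : IsOpen D) {a : smoothAlgebra D} {f : E → ℝ}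
    (hf : ∀ p : D, f p = a.1 p) (p : D) : fderiv ℝ (smoothExt a) p = fderiv ℝ f p := by
  refine Filter.EventuallyEq.fderiv_eq ?_
  filter_upwards [hD.mem_nhds p.2] with q hq
  rw [smoothExt_apply a ⟨q, hq⟩, hf ⟨q, hq⟩]

lemma differentiableAt_smoothExt (hD : IsOpen D) (a : smoothAlgebra D) (p : D) :
    DifferentiableAt ℝ (smoothExt a) p :=
  ((contDiffOn_smoothExt a).contDiffAt (hD.mem_nhds p.2)).differentiableAt (by simp)

/-- The directional derivative as a derivation of the smooth algebra. -/
def dirDeriv (hD : IsOpen D) (e : E) : Derivation ℝ (smoothAlgebra D) (smoothAlgebra D) :=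
  Derivation.mk'
    { toFun := fun a => ⟨fun p => fderiv ℝ (smoothExt a) p e, fun p => fderiv ℝ (smoothExt a) p e,
        ((contDiffOn_smoothExt a).fderiv_of_isOpen hD (m := ∞) (by simp)).clm_apply
          contDiffOn_const, fun _ => rfl⟩
      map_add' := fun a b => by
        ext p
        have := fderiv_smoothExt hD (a := a + b) (f := fun q => smoothExt a q + smoothExt b q)
          (fun q => by simp [smoothExt_apply]) p
        simp only [this]
        rw [fderiv_fun_add (differentiableAt_smoothExt hD a p) (differentiableAt_smoothExt hD b p)]
        rfl
      map_smul' := fun c a => by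
        ext p
        have := fderiv_smoothExt hD (a := c • a) (f := fun q => c * smoothExt a q)
          (fun q => by simp [smoothExt_apply]) p
        simp only [this]
        rw [fderiv_const_mul (differentiableAt_smoothExt hD a p)]
        rfl }
    fun a b => by
      ext p
      have := fderiv_smoothExt hD (a := a * b) (f := fun q => smoothExt a q * smoothExt b q)
        (fun q => by simp [smoothExt_apply]) p
      simp only [LinearMap.coe_mk, AddHom.coe_mk, this]
      rw [fderiv_fun_mul (differentiableAt_smoothExt hD a p) (differentiableAt_smoothExt hD b p)]
      simp [smoothExt_apply]

lemma dirDeriv_apply (hD : IsOpen D) (e : E) {a : smoothAlgebra D} {f : E → ℝ}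
    (hf : ∀ p : D, f p = a.1 p) (p : D) : (dirDeriv hD e a).1 p = fderiv ℝ f p e := by
  rw [← fderiv_smoothExt hD hf]; rfl

lemma dirDeriv_comm (hD : IsOpen D) (e e' : E) (a : smoothAlgebra D) :
    dirDeriv hD e (dirDeriv hD e' a) = dirDeriv hD e' (dirDeriv hD e a) := by
  ext p
  have key : ∀ d d' : E, (dirDeriv hD d (dirDeriv hD d' a)).1 p =
      fderiv ℝ (fderiv ℝ (smoothExt a)) p d d' := by
    intro d d'
    rw [dirDeriv_apply hD d (f := fun q => fderiv ℝ (smoothExt a) q d') fun q => rfl]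
    have : DifferentiableAt ℝ (fderiv ℝ (smoothExt a)) p :=
      (((contDiffOn_smoothExt a).fderiv_of_isOpen hD (m := ∞) (by simp)).contDiffAt
        (hD.mem_nhds p.2)).differentiableAt (by simp)
    rw [fderiv_clm_apply this (differentiableAt_const _)]
    simp
  rw [key, key]
  exact ((contDiffOn_smoothExt a).contDiffAt (hD.mem_nhds p.2)).isSymmSndFDerivAt
    (by simpa using WithTop.coe_le_coe.2 (le_top : (2 : ℕ∞) ≤ ⊤)) e e'

lemma isUnit_of_forall_ne_zero {a : smoothAlgebra D} (ha : ∀ p, a.1 p ≠ 0) : IsUnit a := by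
  refine IsUnit.of_mul_eq_one ⟨fun p => (a.1 p)⁻¹, fun p => (smoothExt a p)⁻¹,
    (contDiffOn_smoothExt a).inv fun p hp => ?_, fun p =>
      congrArg (·⁻¹) (smoothExt_apply a p)⟩ ?_
  · rw [smoothExt_apply a ⟨p, hp⟩]; exact ha _
  · ext p
    exact mul_inv_cancel₀ (ha p)

/-- Evaluation at a point. -/
def evalAt (p : D) : smoothAlgebra D →ₐ[ℝ] ℝ :=
  (Pi.evalAlgHom ℝ (fun _ : D => ℝ) p).comp (smoothAlgebra D).val

lemma evalAt_apply (p : D) (a : smoothAlgebra D) : evalAt p a = a.1 p := rfl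

lemma eq_zero_iff_evalAt {a : smoothAlgebra D} : a = 0 ↔ ∀ p, evalAt p a = 0 :=
  ⟨fun h p => by rw [h, map_zero], fun h => Subtype.ext (funext h)⟩

end SmoothAlgebra

section Transfer

variable {n : ℕ} {D : Set (Pt n × Pt n)}

/-- The coordinate calculus on an open set of the slit tangent bundle. -/
def coordCalculus (hD : IsOpen D) : FiberCalculus n (smoothAlgebra D) where
  dx i := dirDeriv hD (Pi.single i 1, 0)
  dy i := dirDeriv hD (0, Pi.single i 1)
  v i := ⟨fun p => p.1.2 i, fun p => p.2 i, by fun_prop, fun _ => rfl⟩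
  dy_comm _ _ _ := dirDeriv_comm _ _ _ _
  dx_dy _ _ _ := dirDeriv_comm _ _ _ _
  dy_v i j := by
    ext p
    rw [dirDeriv_apply hD _ (f := fun p => p.2 j) fun _ => rfl]
    have := ((ContinuousLinearMap.proj (R := ℝ) (φ := fun _ : Fin n => ℝ) j).comp
      (ContinuousLinearMap.snd ℝ (Pt n) (Pt n))).hasFDerivAt (x := p.1)
    change fderiv ℝ ((ContinuousLinearMap.proj (R := ℝ) (φ := fun _ : Fin n => ℝ) j).comp
      (ContinuousLinearMap.snd ℝ (Pt n) (Pt n))) p.1 _ = _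
    rw [this.fderiv]
    simp only [ContinuousLinearMap.comp_apply, ContinuousLinearMap.coe_snd',
      ContinuousLinearMap.proj_apply, Pi.single_apply, eq_comm]
    split_ifs <;> rfl
  dx_v i j := by
    ext p
    rw [dirDeriv_apply hD _ (f := fun p => p.2 j) fun _ => rfl]
    have := ((ContinuousLinearMap.proj (R := ℝ) (φ := fun _ : Fin n => ℝ) j).comp
      (ContinuousLinearMap.snd ℝ (Pt n) (Pt n))).hasFDerivAt (x := p.1)
    change fderiv ℝ ((ContinuousLinearMap.proj (R := ℝ) (φ := fun _ : Fin n => ℝ) j).comp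
      (ContinuousLinearMap.snd ℝ (Pt n) (Pt n))) p.1 _ = _
    rw [this.fderiv]
    simp

/-- `f` restricts to `a` on `D`. -/
def Represents (f : Pt n → Pt n → ℝ) (a : smoothAlgebra D) : Prop :=
  ∀ p : D, f p.1.1 p.1.2 = evalAt p a

namespace Represents

lemma exists_of_contDiffOn {f : Pt n → Pt n → ℝ}
    (hf : ContDiffOn ℝ ∞ (Function.uncurry f) D) : ∃ a : smoothAlgebra D, Represents f a :=
  ⟨⟨fun p => f p.1.1 p.1.2, Function.uncurry f, hf, fun _ => rfl⟩, fun _ => rfl⟩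

variable {f : Pt n → Pt n → ℝ} {a : smoothAlgebra D}

lemma differentiableAt (hf : Represents f a) (hD : IsOpen D) (p : D) :
    DifferentiableAt ℝ (Function.uncurry f) p.1 := by
  refine (differentiableAt_smoothExt hD a p).congr_of_eventuallyEq ?_
  filter_upwards [hD.mem_nhds p.2] with q hq
  rw [smoothExt_apply a ⟨q, hq⟩]
  exact hf ⟨q, hq⟩

lemma differentiableAt_right (hf : Represents f a) (hD : IsOpen D) (p : D) :
    DifferentiableAt ℝ (f p.1.1) p.1.2 :=
  (hf.differentiableAt hD p).comp (f := fun y => (p.1.1, y)) p.1.2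
    ((differentiableAt_const _).prodMk differentiableAt_id)

lemma pdy (hf : Represents f a) (hD : IsOpen D) (i : Fin n) :
    Represents (pdy f i) ((coordCalculus hD).dy i a) := by
  intro p
  have h1 := (hf.differentiableAt hD p).hasFDerivAt
  have h2 : HasFDerivAt (fun y : Pt n => (p.1.1, y)) (ContinuousLinearMap.inr ℝ (Pt n) (Pt n))
    p.1.2 := hasFDerivAt_prodMk_right _ _
  have h3 := h1.comp (f := fun y => (p.1.1, y)) p.1.2 h2
  refine (congrArg (· (Pi.single i 1)) h3.fderiv).trans ?_
  exact (dirDeriv_apply hD _ (f := Function.uncurry f) (fun q => hf q) p).symm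

lemma pdx (hf : Represents f a) (hD : IsOpen D) (i : Fin n) :
    Represents (pdx f i) ((coordCalculus hD).dx i a) := by
  intro p
  have h1 := (hf.differentiableAt hD p).hasFDerivAt
  have h2 : HasFDerivAt (fun x : Pt n => (x, p.1.2)) (ContinuousLinearMap.inl ℝ (Pt n) (Pt n))
    p.1.1 := hasFDerivAt_prodMk_left _ _
  have h3 := h1.comp (f := fun x => (x, p.1.2)) p.1.1 h2
  refine (congrArg (· (Pi.single i 1)) h3.fderiv).trans ?_
  exact (dirDeriv_apply hD _ (f := Function.uncurry f) (fun q => hf q) p).symm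

end Represents

end Transfer
end

noncomputable section
open scoped ContDiff

lemma Matrix.map_nonsing_inv {m R S : Type*} [Fintype m] [DecidableEq m] [CommRing R] [CommRing S]
    (φ : R →+* S) {M : Matrix m m R} (hM : IsUnit M.det) : (M.map φ)⁻¹ = M⁻¹.map φ := by
  refine Matrix.inv_eq_right_inv ?_
  rw [← Matrix.map_mul, Matrix.mul_nonsing_inv _ hM, Matrix.map_one _ φ.map_zero φ.map_one]

section Dictionary

variable {n : ℕ} {D : Set (Pt n × Pt n)} (hD : IsOpen D) {F : Pt n → Pt n → ℝ}
  {f u : smoothAlgebra D}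

lemma represents_F2 (hf : Represents F f) : Represents (F2 F) (f ^ 2) := fun p => by
  rw [map_pow, ← hf p]; rfl

lemma represents_inv (hf : Represents F f) (hu : f * u = 1) (p : D) :
    evalAt p u = (F p.1.1 p.1.2)⁻¹ := by
  refine eq_inv_of_mul_eq_one_right ?_
  rw [hf p, ← map_mul, hu, map_one]

lemma represents_gLow (hf : Represents F f) (i j : Fin n) :
    Represents (gLow F i j) ((coordCalculus hD).fund (f ^ 2) i j) := fun p => by
  rw [FiberCalculus.fund, map_smul, ← (((represents_F2 hf).pdy hD j).pdy hD i) p]; rfl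

lemma represents_Cartan (hf : Represents F f) (i j k : Fin n) :
    Represents (Cartan F i j k) ((coordCalculus hD).cartan (f ^ 2) i j k) := fun p => by
  rw [FiberCalculus.cartan, map_smul, ← ((((represents_F2 hf).pdy hD k).pdy hD j).pdy hD i) p]; rfl

lemma evalAt_v (p : D) (i : Fin n) : evalAt p ((coordCalculus hD).v i) = p.1.2 i := rfl

lemma represents_yLow (hf : Represents F f) (i : Fin n) :
    Represents (yLow F i) ((coordCalculus hD).low (f ^ 2) i) := fun p => by
  simp only [FiberCalculus.low, map_sum, map_mul, ← represents_gLow hD hf _ _ p, evalAt_v, yLow]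

lemma represents_hLow (hf : Represents F f) (hu : f * u = 1) (i j : Fin n) :
    Represents (hLow F i j) ((coordCalculus hD).ang (f ^ 2) u i j) := fun p => by
  simp only [FiberCalculus.ang, map_sub, map_mul, map_pow, ← represents_gLow hD hf _ _ p,
    ← represents_yLow hD hf _ p, represents_inv hf hu, hLow, div_eq_mul_inv, inv_pow]

lemma represents_hUp (hf : Represents F f) (hu : f * u = 1) (i j : Fin n) :
    Represents (hUp F i j) ((coordCalculus hD).proj (f ^ 2) u i j) := fun p => by
  simp only [FiberCalculus.proj, map_sub, map_mul, map_pow, evalAt_v, apply_ite (evalAt p), map_one,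
    map_zero, ← represents_yLow hD hf _ p, represents_inv hf hu, hUp, div_eq_mul_inv, inv_pow]

lemma gMat_eq_map (hf : Represents F f) (p : D) :
    gMat F p.1.1 p.1.2 = (Matrix.of ((coordCalculus hD).fund (f ^ 2))).map (evalAt p).toRingHom := by
  ext i j
  exact represents_gLow hD hf i j p

lemma isUnit_det_fund (hf : Represents F f)
    (hpos : ∀ p : D, (gMat F p.1.1 p.1.2).PosDef) :
    IsUnit (Matrix.of ((coordCalculus hD).fund (f ^ 2))).det := by
  refine isUnit_of_forall_ne_zero fun p => ?_
  have h := (hpos p).det_pos.ne'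
  rw [gMat_eq_map hD hf] at h
  rwa [← evalAt_apply, ← AlgHom.coe_toRingHom, RingHom.map_det]

lemma represents_gInv (hf : Represents F f)
    (hdet : IsUnit (Matrix.of ((coordCalculus hD).fund (f ^ 2))).det) (i j : Fin n) :
    Represents (gInv F i j) ((Matrix.of ((coordCalculus hD).fund (f ^ 2)))⁻¹ i j) := fun p => by
  rw [gInv, gMat_eq_map hD hf, Matrix.map_nonsing_inv _ hdet]; rfl

lemma represents_Gspray (hf : Represents F f)
    (hdet : IsUnit (Matrix.of ((coordCalculus hD).fund (f ^ 2))).det) (i : Fin n) :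
    Represents (Gspray F i) ((coordCalculus hD).sprayCoeff (f ^ 2) i) := fun p => by
  have h1 := fun k l => ((represents_F2 hf).pdy hD l).pdx hD k p
  have h2 := fun l => (represents_F2 hf).pdx hD l p
  simp only [FiberCalculus.sprayCoeff, map_smul, map_sum, map_mul, map_sub, evalAt_v, ← h1, ← h2,
    ← represents_gInv hD hf hdet _ _ p, smul_eq_mul, Gspray]

variable {G : Fin n → smoothAlgebra D} (hG : ∀ i, Represents (Gspray F i) (G i))
include hG

lemma represents_Ncon (i j : Fin n) : Represents (Ncon F i j) ((coordCalculus hD).dy j (G i)) :=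
  (hG i).pdy hD j

lemma represents_Γcon (i j k : Fin n) :
    Represents (Γcon F i j k) ((coordCalculus hD).dy j ((coordCalculus hD).dy k (G i))) :=
  ((hG i).pdy hD k).pdy hD j

lemma represents_Bcurv (i j k l : Fin n) :
    Represents (Bcurv F i j k l) ((coordCalculus hD).berwald G i j k l) :=
  (((hG i).pdy hD l).pdy hD k).pdy hD j

lemma represents_Ecurv (j k : Fin n) :
    Represents (Ecurv F j k) ((coordCalculus hD).meanBerwald G j k) := fun p => by
  simp only [FiberCalculus.meanBerwald, map_smul, map_sum, ← represents_Bcurv hD hG _ _ _ _ p,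
    smul_eq_mul, Ecurv]

lemma represents_hD0 {t : Pt n → Pt n → ℝ} {a : smoothAlgebra D} (ht : Represents t a) (m : Fin n) :
    Represents (hD0 F t m) ((coordCalculus hD).hor G m a) := fun p => by
  have h1 := fun r => ht.pdy hD r p
  simp only [FiberCalculus.hor_apply, map_sub, map_sum, map_mul, ← ht.pdx hD m p, ← h1,
    ← represents_Ncon hD hG _ _ p, hD0]

lemma represents_hD2 {t : Fin n → Fin n → Pt n → Pt n → ℝ} {T : Fin n → Fin n → smoothAlgebra D}
    (ht : ∀ i j, Represents (t i j) (T i j)) (j k m : Fin n) :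
    Represents (hD2 F t j k m) ((coordCalculus hD).hor2 G T j k m) := fun p => by
  simp only [FiberCalculus.hor2, map_sub, map_sum, map_mul,
    ← represents_hD0 hD hG (ht _ _) m p, ← ht _ _ p, ← represents_Γcon hD hG _ _ _ p, hD2]

lemma represents_hD3 {t : Fin n → Fin n → Fin n → Pt n → Pt n → ℝ}
    {T : Fin n → Fin n → Fin n → smoothAlgebra D}
    (ht : ∀ i j k, Represents (t i j k) (T i j k)) (i j k m : Fin n) :
    Represents (hD3 F t i j k m) ((coordCalculus hD).hor3 G T i j k m) := fun p => by
  simp only [FiberCalculus.hor3, map_sub, map_sum, map_mul,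
    ← represents_hD0 hD hG (ht _ _ _) m p, ← ht _ _ _ p, ← represents_Γcon hD hG _ _ _ p, hD3]

lemma represents_Land (hf : Represents F f) (i j k : Fin n) :
    Represents (Land F i j k) ((coordCalculus hD).land (f ^ 2) G i j k) := fun p => by
  simp only [FiberCalculus.land, map_sum, map_mul, evalAt_v,
    ← represents_hD3 hD hG (represents_Cartan hD hf) _ _ _ _ p, Land]

lemma represents_Stretch (hf : Represents F f) (i j k l : Fin n) :
    Represents (Stretch F i j k l)
      (2 * ((coordCalculus hD).hor3 G ((coordCalculus hD).land (f ^ 2) G) i j k l -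
        (coordCalculus hD).hor3 G ((coordCalculus hD).land (f ^ 2) G) i j l k)) := fun p => by
  simp only [map_mul, map_ofNat, map_sub,
    ← represents_hD3 hD hG (represents_Land hD hG hf) _ _ _ _ p, Stretch]

lemma represents_RiemK (i k : Fin n) :
    Represents (RiemK F i k) ((coordCalculus hD).riem G i k) := fun p => by
  have h1 := fun i k => (hG i).pdx hD k p
  have h2 := fun i k j => ((hG i).pdy hD k).pdx hD j p
  simp only [FiberCalculus.riem, map_sub, map_add, map_mul, map_ofNat, map_sum, evalAt_v, ← h1,
    ← h2, ← hG _ p, ← represents_Γcon hD hG _ _ _ p, ← represents_Ncon hD hG _ _ p, RiemK]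

lemma represents_Riem4 (i j k l : Fin n) :
    Represents (Riem4 F i j k l) ((coordCalculus hD).riem4 G i j k l) := fun p => by
  have h : Represents
      (fun x' y' => pdy (RiemK F i k) l x' y' - pdy (RiemK F i l) k x' y')
      ((coordCalculus hD).dy l ((coordCalculus hD).riem G i k) -
        (coordCalculus hD).dy k ((coordCalculus hD).riem G i l)) := fun q => by
    rw [map_sub, ← (represents_RiemK hD hG i k).pdy hD l q,
      ← (represents_RiemK hD hG i l).pdy hD k q]
  rw [FiberCalculus.riem4, map_smul, ← h.pdy hD j p]; rfl

end Dictionary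

section SlitBundle

variable {n : ℕ} {U : Set (Pt n)} {F : Pt n → Pt n → ℝ}

lemma clm_apply_eq_sum (L : Pt n →L[ℝ] ℝ) (w : Pt n) :
    L w = ∑ r, w r * L (Pi.single r 1) := by
  conv_lhs => rw [← Finset.univ_sum_single w, map_sum]
  refine Finset.sum_congr rfl fun r _ => ?_
  rw [← smul_eq_mul, ← map_smul, ← Pi.single_smul, smul_eq_mul, mul_one]

lemma isOpen_slitBundle (hU : IsOpen U) : IsOpen (U ×ˢ {y : Pt n | y ≠ 0}) :=
  hU.prod isOpen_ne

lemma euler_sq (hD : IsOpen (U ×ˢ {y : Pt n | y ≠ 0}))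
    (hom : ∀ x ∈ U, ∀ y : Pt n, y ≠ 0 → ∀ t : ℝ, 0 < t → F x (t • y) = t * F x y)
    {f : smoothAlgebra (U ×ˢ {y : Pt n | y ≠ 0})} (hf : Represents F f) :
    (coordCalculus hD).euler (f ^ 2) = 2 * f ^ 2 := by
  rw [← sub_eq_zero, eq_zero_iff_evalAt]
  intro p
  have hd := ((represents_F2 hf).differentiableAt_right hD p).hasFDerivAt
  have hs : HasDerivAt (fun t : ℝ => t • p.1.2) p.1.2 1 := by
    simpa using (hasDerivAt_id (1 : ℝ)).smul_const p.1.2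
  have h1 := HasFDerivAt.comp_hasDerivAt (1 : ℝ) (f := fun t : ℝ => t • p.1.2)
    (l := F2 F p.1.1) (by simpa using hd) hs
  have h2 : HasDerivAt (fun t : ℝ => t ^ 2 * F2 F p.1.1 p.1.2) (2 * F2 F p.1.1 p.1.2) 1 := by
    simpa using ((hasDerivAt_id (1 : ℝ)).pow 2).mul_const (F2 F p.1.1 p.1.2)
  have h3 : (F2 F p.1.1 ∘ fun t : ℝ => t • p.1.2) =ᶠ[nhds 1]
      fun t : ℝ => t ^ 2 * F2 F p.1.1 p.1.2 := by
    filter_upwards [lt_mem_nhds one_pos] with t ht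
    simp only [Function.comp, F2, hom _ p.2.1 _ p.2.2 t ht, mul_pow]
  have h4 := h1.unique (h2.congr_of_eventuallyEq h3)
  have h5 := fun r => (represents_F2 hf).pdy hD r p
  simp only [FiberCalculus.euler_apply, map_sub, map_sum, map_mul, map_ofNat, evalAt_v, ← h5,
    ← represents_F2 hf p]
  rw [sub_eq_zero, ← h4]
  exact (clm_apply_eq_sum _ _).symm

/-- A function on the slit bundle is fibrewise constant iff its vertical derivatives vanish. -/
lemma forall_eq_iff_dy_eq_zero (hn : 2 ≤ n) (hD : IsOpen (U ×ˢ {y : Pt n | y ≠ 0}))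
    {f : Pt n → Pt n → ℝ} {a : smoothAlgebra (U ×ˢ {y : Pt n | y ≠ 0})} (hf : Represents f a) :
    (∀ x ∈ U, ∀ y y' : Pt n, y ≠ 0 → y' ≠ 0 → f x y = f x y') ↔
      ∀ m, (coordCalculus hD).dy m a = 0 := by
  constructor
  · intro h m
    rw [eq_zero_iff_evalAt]
    intro p
    rw [← hf.pdy hD m p]
    have : (fun y' => f p.1.1 y') =ᶠ[nhds p.1.2] fun _ => f p.1.1 p.1.2 := by
      filter_upwards [isOpen_ne.mem_nhds p.2.2] with y hy
      exact h _ p.2.1 _ _ hy p.2.2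
    rw [pdy, this.fderiv_eq, fderiv_fun_const]
    rfl
  · intro h x hx y y' hy hy'
    have hc : IsPreconnected {y : Pt n | y ≠ 0} :=
      (isConnected_compl_singleton_of_one_lt_rank (by
        rw [rank_fin_fun]; exact_mod_cast hn) (0 : Pt n)).isPreconnected
    refine IsOpen.is_const_of_fderiv_eq_zero (𝕜 := ℝ) isOpen_ne hc (f := f x) (fun z hz => ?_)
      (fun z hz => ?_) hy hy'
    · exact (hf.differentiableAt_right hD ⟨(x, z), hx, hz⟩).differentiableWithinAt
    · ext w
      rw [clm_apply_eq_sum]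
      refine Finset.sum_eq_zero fun r _ => ?_
      have := hf.pdy hD r ⟨(x, z), hx, hz⟩
      rw [h r, map_zero] at this
      exact mul_eq_zero_of_right _ this

end SlitBundle
end

/-- **Theorem 3.** On a generalized isotropic Berwald manifold of dimension `n > 2`,
`F` is R-quadratic iff it is a stretch metric with vanishing `Ē`-curvature. -/
theorem gib_Rquadratic_iff_stretch_and_Ebar_zero {n : ℕ} (hn : 2 < n)
    (U : Set (Pt n)) (F μ lam : Pt n → Pt n → ℝ) (hF : IsGIB U F μ lam) :
    RQuadratic U F ↔
      ((∀ x ∈ U, ∀ y : Pt n, y ≠ 0 → ∀ i j k l : Fin n, Stretch F i j k l x y = 0) ∧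
       (∀ x ∈ U, ∀ y : Pt n, y ≠ 0 → ∀ j k l : Fin n, hD2 F (Ecurv F) j k l x y = 0)) := by
  have hD := isOpen_slitBundle hF.finsler.isOpen
  obtain ⟨f, hf⟩ := Represents.exists_of_contDiffOn hF.finsler.smooth
  obtain ⟨m, hm⟩ := Represents.exists_of_contDiffOn hF.smooth_mu
  obtain ⟨c, hc⟩ := Represents.exists_of_contDiffOn hF.smooth_lam
  have hunit : IsUnit f := isUnit_of_forall_ne_zero fun p => by
    rw [← evalAt_apply, ← hf p]
    exact (hF.finsler.pos _ p.2.1 _ p.2.2).ne'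
  obtain ⟨u, hu⟩ := hunit.exists_right_inv
  have hdet := isUnit_det_fund hD hf fun p => hF.finsler.posdef _ p.2.1 _ p.2.2
  have hS := (coordCalculus hD).isSpray_sprayCoeff (hunit.pow 2)
    (euler_sq hD hF.finsler.homog hf) hdet
  have hG := represents_Gspray hD hf hdet
  have zero_iff : ∀ {t : Pt n → Pt n → ℝ} {a : smoothAlgebra (U ×ˢ {y : Pt n | y ≠ 0})},
      Represents t a → ((∀ x ∈ U, ∀ y : Pt n, y ≠ 0 → t x y = 0) ↔ a = 0) := by
    intro t a ht
    rw [eq_zero_iff_evalAt]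
    exact ⟨fun h p => (ht p).symm.trans (h _ p.2.1 _ p.2.2),
      fun h x hx y hy => (ht ⟨(x, y), hx, hy⟩).trans (h _)⟩
  have key := hS.gib_iff hn (u := u) (μ := m) (lam := c)
    (by rw [← mul_pow, mul_comm, hu, one_pow]) fun i j k l => by
      rw [← sub_eq_zero, eq_zero_iff_evalAt]
      intro p
      have := hF.berwald _ p.2.1 _ p.2.2 i j k l
      simp only [map_sub, map_mul, map_add, evalAt_v, ← represents_Bcurv hD hG _ _ _ _ p,
        ← represents_hUp hD hf hu _ _ p, ← represents_hLow hD hf hu _ _ p,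
        ← represents_Cartan hD hf _ _ _ p, ← hm p, ← hc p, represents_inv hf hu]
      rw [this, sub_eq_zero]
      rfl
  have h1 : RQuadratic U F ↔ ∀ i j k l m, (coordCalculus hD).dy m
      ((coordCalculus hD).riem4 ((coordCalculus hD).sprayCoeff (f ^ 2)) i j k l) = 0 := by
    simp only [← forall_eq_iff_dy_eq_zero hn.le hD (represents_Riem4 hD hG _ _ _ _)]
    exact ⟨fun h i j k l x hx y y' hy hy' => h x hx y y' hy hy' i j k l,
      fun h x hx y y' hy hy' i j k l => h i j k l x hx y y' hy hy'⟩
  rw [h1, key]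
  simp only [← zero_iff (represents_Stretch hD hG hf _ _ _ _),
    ← zero_iff (represents_hD2 hD hG (represents_Ecurv hD hG) _ _ _)]
  exact and_congr ⟨fun h x hx y hy i j k l => h i j k l x hx y hy,
      fun h i j k l x hx y hy => h x hx y hy i j k l⟩
    ⟨fun h x hx y hy i j k => h i j k x hx y hy, fun h i j k x hx y hy => h x hx y hy i j k⟩
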